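/- Suppose E and Ẽ differ only in the links starting from a node i. Then 1 − c·δ^T (I − cP)^{−1} e_i > 0 and the PageRanks of I in the two graphs satisfy π̃^T e_I = π^T e_I + c·π_i · (δ^T v) / (1 − c·δ^T (I − cP)^{−1} e_i). -/

import Mathlib

open Matrix Finset

/-- Outdegree of node `i` in the edge set `E`. -/
def outdeg {n : ℕ} (E : Finset (Fin n × Fin n)) (i : Fin n) : ℕ :=
  (Finset.univ.filter (fun j => (i, j) ∈ E)).card

/-- The scaled adjacency matrix `P` of the graph: `P i j = 1 / outdeg i` if `(i,j) ∈ E`. -/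
noncomputable def Pmat {n : ℕ} (E : Finset (Fin n × Fin n)) : Matrix (Fin n) (Fin n) ℝ :=
  fun i j => if (i, j) ∈ E then ((outdeg E i : ℝ))⁻¹ else 0

/-- Indicator vector of a set of nodes. -/
def ind {n : ℕ} (I : Finset (Fin n)) : Fin n → ℝ :=
  fun i => if i ∈ I then 1 else 0

/-- `v = (Id - cP)⁻¹ e_I`, the vector of mean numbers of visits to `I` before zapping. -/
noncomputable def vvec {n : ℕ} (c : ℝ) (E : Finset (Fin n × Fin n)) (I : Finset (Fin n)) : Fin n → ℝ :=
  (1 - c • Pmat E)⁻¹ *ᵥ ind I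

/-- PageRank vector `πᵀ = (1-c) zᵀ (Id - cP)⁻¹`. -/
noncomputable def pr {n : ℕ} (c : ℝ) (z : Fin n → ℝ) (E : Finset (Fin n × Fin n)) : Fin n → ℝ :=
  (1 - c) • (((1 - c • Pmat E)⁻¹)ᵀ *ᵥ z)

/-- PageRank of the set `I`: `πᵀ e_I`. -/
noncomputable def prSet {n : ℕ} (c : ℝ) (z : Fin n → ℝ) (E : Finset (Fin n × Fin n))
    (I : Finset (Fin n)) : ℝ :=
  ∑ i ∈ I, pr c z E i

/-- Node `i` has access to (some node of) the set `J`: `i ∈ J` or a directed path from `i`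
reaches `J`. -/
def access {n : ℕ} (E : Finset (Fin n × Fin n)) (i : Fin n) (J : Finset (Fin n)) : Prop :=
  ∃ j ∈ J, Relation.ReflTransGen (fun a b => (a, b) ∈ E) i j

/-- The correction vector `δ` for a change of the links starting from node `i`:
`δ = Σ_{j : (i,j) ∈ Ẽ} e_j / d̃_i − Σ_{j : (i,j) ∈ E} e_j / d_i`. -/
noncomputable def delta {n : ℕ} (E Et : Finset (Fin n × Fin n)) (i : Fin n) : Fin n → ℝ :=
  fun j => (if (i, j) ∈ Et then ((outdeg Et i : ℝ))⁻¹ else 0)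
         - (if (i, j) ∈ E then ((outdeg E i : ℝ))⁻¹ else 0)

lemma Pmat_nonneg {n : ℕ} (E : Finset (Fin n × Fin n)) (i j : Fin n) : 0 ≤ Pmat E i j := by
  unfold Pmat
  split_ifs
  · positivity
  · exact le_rfl

lemma Pmat_sum {n : ℕ} (E : Finset (Fin n × Fin n)) (hE : ∀ i, 0 < outdeg E i) (i : Fin n) :
    ∑ j, Pmat E i j = 1 := by
  have h : ((outdeg E i : ℕ) : ℝ) ≠ 0 := by exact_mod_cast (hE i).ne'
  simp only [Pmat]
  rw [← Finset.sum_filter, Finset.sum_const, nsmul_eq_mul]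
  exact mul_inv_cancel₀ h

lemma A_apply {n : ℕ} (E : Finset (Fin n × Fin n)) (c : ℝ) (u : Fin n → ℝ) (k : Fin n) :
    ((1 - c • Pmat E) *ᵥ u) k = u k - c * ∑ j, Pmat E k j * u j := by
  rw [sub_mulVec, smul_mulVec, one_mulVec]
  rfl

/-- Minimum principle. -/
lemma min_principle {n : ℕ} (E : Finset (Fin n × Fin n)) (hE : ∀ i, 0 < outdeg E i)
    (c : ℝ) (hc0 : 0 < c) (hc1 : c < 1) (u : Fin n → ℝ)
    (hu : ∀ k, 0 ≤ ((1 - c • Pmat E) *ᵥ u) k) (k : Fin n) : 0 ≤ u k := by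
  have : Nonempty (Fin n) := ⟨k⟩
  obtain ⟨m, hm⟩ := Finite.exists_min u
  have h := hu m
  rw [A_apply] at h
  have h2 : u m ≤ ∑ j, Pmat E m j * u j := by
    calc u m = ∑ j, Pmat E m j * u m := by rw [← Finset.sum_mul, Pmat_sum E hE, one_mul]
      _ ≤ _ := Finset.sum_le_sum fun j _ => mul_le_mul_of_nonneg_left (hm j) (Pmat_nonneg E m j)
  have h3 := hm k
  nlinarith

lemma A_unit {n : ℕ} (E : Finset (Fin n × Fin n)) (hE : ∀ i, 0 < outdeg E i)
    (c : ℝ) (hc0 : 0 < c) (hc1 : c < 1) : IsUnit (1 - c • Pmat E).det := by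
  rw [← Matrix.isUnit_iff_isUnit_det, ← Matrix.mulVec_injective_iff_isUnit]
  intro u v huv
  have h : ∀ a b : Fin n → ℝ, (1 - c • Pmat E) *ᵥ a = (1 - c • Pmat E) *ᵥ b → ∀ k, b k ≤ a k := by
    intro a b hab k
    have := min_principle E hE c hc0 hc1 (a - b) (by intro k; rw [mulVec_sub, hab]; simp) k
    simpa using this
  funext k
  exact le_antisymm (h _ _ huv.symm k) (h _ _ huv k)

lemma w_pos {n : ℕ} (E : Finset (Fin n × Fin n)) (hE : ∀ i, 0 < outdeg E i)
    (c : ℝ) (hc0 : 0 < c) (hc1 : c < 1) (i : Fin n) :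
    0 < ((1 - c • Pmat E)⁻¹ *ᵥ Pi.single i 1) i := by
  have hA := A_unit E hE c hc0 hc1
  set w := (1 - c • Pmat E)⁻¹ *ᵥ (Pi.single i 1 : Fin n → ℝ) with hw
  have h1 : (1 - c • Pmat E) *ᵥ w = Pi.single i 1 := by
    rw [hw, mulVec_mulVec, Matrix.mul_nonsing_inv _ hA, one_mulVec]
  have h0 : ∀ k, 0 ≤ w k := by
    apply min_principle E hE c hc0 hc1
    intro k
    rw [h1]
    by_cases h : k = i
    · subst h; simp
    · simp [h]
  have h2 := congrFun h1 i
  rw [A_apply, Pi.single_eq_same] at h2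
  have h3 : 0 ≤ ∑ j, Pmat E i j * w j :=
    Finset.sum_nonneg fun j _ => mul_nonneg (Pmat_nonneg E i j) (h0 j)
  nlinarith [mul_nonneg hc0.le h3]

lemma A_diff {n : ℕ} (E Et : Finset (Fin n × Fin n)) (c : ℝ) (i : Fin n)
    (hdiff : ∀ k, k ≠ i → ∀ j, ((k, j) ∈ E ↔ (k, j) ∈ Et)) (u : Fin n → ℝ) :
    (1 - c • Pmat Et) *ᵥ u = (1 - c • Pmat E) *ᵥ u
      - (c * (delta E Et i ⬝ᵥ u)) • (Pi.single i 1 : Fin n → ℝ) := by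
  funext k
  rw [Pi.sub_apply, A_apply, A_apply]
  by_cases h : k = i
  · subst h
    have : delta E Et k ⬝ᵥ u = ∑ j, Pmat Et k j * u j - ∑ j, Pmat E k j * u j := by
      rw [← Finset.sum_sub_distrib]
      exact Finset.sum_congr rfl fun j _ => by simp only [delta, Pmat]; ring
    rw [this]
    simp
    ring
  · have hP : ∀ j, Pmat E k j = Pmat Et k j := by
      intro j
      simp only [Pmat, outdeg, hdiff k h]
    simp [h, hP]

lemma prSet_eq {n : ℕ} (E : Finset (Fin n × Fin n)) (c : ℝ) (z : Fin n → ℝ)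
    (I : Finset (Fin n)) : prSet c z E I = (1 - c) * (z ⬝ᵥ vvec c E I) := by
  have h : prSet c z E I = pr c z E ⬝ᵥ ind I := by
    simp [prSet, dotProduct, ind]
  rw [h, pr, smul_dotProduct, vvec, mulVec_transpose, dotProduct_mulVec, smul_eq_mul]

lemma pr_eq {n : ℕ} (E : Finset (Fin n × Fin n)) (c : ℝ) (z : Fin n → ℝ) (i : Fin n) :
    pr c z E i = (1 - c) * (z ⬝ᵥ ((1 - c • Pmat E)⁻¹ *ᵥ Pi.single i 1)) := by
  rw [pr, mulVec_transpose, dotProduct_mulVec, dotProduct_single, mul_one]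
  rfl

/-- Lemma 4: if `E` and `Ẽ` differ only in the links starting from node `i`, then
`1 - c δᵀ (Id - cP)⁻¹ e_i > 0` and
`π̃ᵀ e_I = πᵀ e_I + c π_i (δᵀ v) / (1 - c δᵀ (Id - cP)⁻¹ e_i)`. -/
theorem stmt5 {n : ℕ} (hn : 1 ≤ n) (E Et : Finset (Fin n × Fin n))
    (hE : ∀ i, 0 < outdeg E i) (hEt : ∀ i, 0 < outdeg Et i)
    (c : ℝ) (hc0 : 0 < c) (hc1 : c < 1)
    (z : Fin n → ℝ) (hz : ∀ i, 0 < z i) (hz1 : ∑ i, z i = 1)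
    (I : Finset (Fin n)) (i : Fin n)
    (hdiff : ∀ k, k ≠ i → ∀ j, ((k, j) ∈ E ↔ (k, j) ∈ Et)) :
    0 < 1 - c * (delta E Et i ⬝ᵥ ((1 - c • Pmat E)⁻¹ *ᵥ Pi.single i 1)) ∧
    prSet c z Et I = prSet c z E I +
      c * pr c z E i * (delta E Et i ⬝ᵥ vvec c E I) /
        (1 - c * (delta E Et i ⬝ᵥ ((1 - c • Pmat E)⁻¹ *ᵥ Pi.single i 1))) := by
  have hA := A_unit E hE c hc0 hc1
  have hB := A_unit Et hEt c hc0 hc1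
  have hw := w_pos E hE c hc0 hc1 i
  have hwt := w_pos Et hEt c hc0 hc1 i
  have hAw : (1 - c • Pmat E) *ᵥ ((1 - c • Pmat E)⁻¹ *ᵥ (Pi.single i 1 : Fin n → ℝ))
      = Pi.single i 1 := by
    rw [mulVec_mulVec, Matrix.mul_nonsing_inv _ hA, one_mulVec]
  have hAv : (1 - c • Pmat E) *ᵥ vvec c E I = ind I := by
    rw [vvec, mulVec_mulVec, Matrix.mul_nonsing_inv _ hA, one_mulVec]
  have hpr := pr_eq E c z i
  have hBw := A_diff E Et c i hdiff ((1 - c • Pmat E)⁻¹ *ᵥ (Pi.single i 1 : Fin n → ℝ))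
  have hBv := A_diff E Et c i hdiff (vvec c E I)
  rw [hAw] at hBw
  rw [hAv] at hBv
  set w := (1 - c • Pmat E)⁻¹ *ᵥ (Pi.single i 1 : Fin n → ℝ)
  set s := 1 - c * (delta E Et i ⬝ᵥ w) with hs
  have hinv : ∀ u : Fin n → ℝ, (1 - c • Pmat Et)⁻¹ *ᵥ ((1 - c • Pmat Et) *ᵥ u) = u := by
    intro u
    rw [mulVec_mulVec, Matrix.nonsing_inv_mul _ hB, one_mulVec]
  have h1 := hinv w
  have h2 := hinv (vvec c E I)
  rw [hBw, mulVec_sub, mulVec_smul] at h1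
  rw [hBv, mulVec_sub, mulVec_smul] at h2
  change vvec c Et I - _ = _ at h2
  set wt := (1 - c • Pmat Et)⁻¹ *ᵥ (Pi.single i 1 : Fin n → ℝ)
  have h3 : w = s • wt := by
    rw [← h1, hs, sub_smul, one_smul]
  have hspos : 0 < s := by
    have := congrFun h3 i
    rw [Pi.smul_apply, smul_eq_mul] at this
    rw [this] at hw
    exact pos_of_mul_pos_left hw hwt.le
  refine ⟨hspos, ?_⟩
  have h4 : vvec c Et I = vvec c E I + (c * (delta E Et i ⬝ᵥ vvec c E I)) • wt := by
    exact sub_eq_iff_eq_add.mp h2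
  rw [prSet_eq, prSet_eq, hpr, h3, h4, dotProduct_add, dotProduct_smul, dotProduct_smul]
  simp only [smul_eq_mul]
  field_simp
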